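/- Let n ≥ 1 and let G : ℂⁿ × ℝ → ℂ be a smooth function satisfying Z̄_α G = 0 for all 1 ≤ α ≤ n and Z_β(Z_α G) = 0 for all 1 ≤ α, β ≤ n. Then the function ∂G/∂t is constant on ℂⁿ × ℝ. -/

import Mathlib

/-- The Wirtinger derivative `∂F/∂z^α = ½(∂F/∂x^α − i ∂F/∂y^α)` of a function on
the Heisenberg group `ℍⁿ = ℂⁿ × ℝ`. -/
noncomputable def pdz {n : ℕ} (α : Fin n) (F : (Fin n → ℂ) × ℝ → ℂ)
    (p : (Fin n → ℂ) × ℝ) : ℂ :=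
  (1 / 2) * (fderiv ℝ F p (Pi.single α 1, 0) -
    Complex.I * fderiv ℝ F p (Pi.single α Complex.I, 0))

/-- The Wirtinger derivative `∂F/∂z̄^α = ½(∂F/∂x^α + i ∂F/∂y^α)`. -/
noncomputable def pdzbar {n : ℕ} (α : Fin n) (F : (Fin n → ℂ) × ℝ → ℂ)
    (p : (Fin n → ℂ) × ℝ) : ℂ :=
  (1 / 2) * (fderiv ℝ F p (Pi.single α 1, 0) +
    Complex.I * fderiv ℝ F p (Pi.single α Complex.I, 0))

/-- The derivative `∂F/∂t` on `ℍⁿ = ℂⁿ × ℝ`. -/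
noncomputable def pdt {n : ℕ} (F : (Fin n → ℂ) × ℝ → ℂ) (p : (Fin n → ℂ) × ℝ) : ℂ :=
  fderiv ℝ F p (0, 1)

/-- The left-invariant Heisenberg vector field `Z_α F = ∂F/∂z^α + i z̄^α ∂F/∂t`. -/
noncomputable def Zh {n : ℕ} (α : Fin n) (F : (Fin n → ℂ) × ℝ → ℂ)
    (p : (Fin n → ℂ) × ℝ) : ℂ :=
  pdz α F p + Complex.I * (starRingEnd ℂ) (p.1 α) * pdt F p

/-- The conjugate Heisenberg vector field `Z̄_α F = ∂F/∂z̄^α − i z^α ∂F/∂t`. -/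
noncomputable def Zhbar {n : ℕ} (α : Fin n) (F : (Fin n → ℂ) × ℝ → ℂ)
    (p : (Fin n → ℂ) × ℝ) : ℂ :=
  pdzbar α F p - Complex.I * (p.1 α) * pdt F p

section HeisenbergCalculus

variable {n : ℕ} {F : (Fin n → ℂ) × ℝ → ℂ}

theorem contDiff_fderiv_const_apply (hF : ContDiff ℝ (⊤ : ℕ∞) F) (v : (Fin n → ℂ) × ℝ) :
    ContDiff ℝ (⊤ : ℕ∞) (fun p => fderiv ℝ F p v) :=
  (hF.fderiv_right (by norm_cast)).clm_apply contDiff_const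

theorem hasFDerivAt_fderiv_const_apply (hF : ContDiff ℝ (⊤ : ℕ∞) F) (v p : (Fin n → ℂ) × ℝ) :
    HasFDerivAt (fun q => fderiv ℝ F q v) 
      ((ContinuousLinearMap.apply ℝ ℂ v).comp (fderiv ℝ (fderiv ℝ F) p)) p := by
  have hd : ContDiff ℝ (⊤ : ℕ∞) (fderiv ℝ F) := hF.fderiv_right (by norm_cast)
  exact (ContinuousLinearMap.apply ℝ ℂ v).hasFDerivAt.comp p
    ((hd.differentiable (by simp)) p).hasFDerivAt

theorem fderiv_fderiv_symm (hF : ContDiff ℝ (⊤ : ℕ∞) F) (p v w : (Fin n → ℂ) × ℝ) :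
    fderiv ℝ (fderiv ℝ F) p v w = fderiv ℝ (fderiv ℝ F) p w v :=
  (hF.contDiffAt.isSymmSndFDerivAt (by
    simp only [minSmoothness_of_isRCLikeNormedField]; exact WithTop.coe_le_coe.2 le_top)) v w

theorem contDiff_coord (α : Fin n) :
    ContDiff ℝ (⊤ : ℕ∞) (fun p : (Fin n → ℂ) × ℝ => p.1 α) := by
  fun_prop

theorem contDiff_conj_coord (α : Fin n) :
    ContDiff ℝ (⊤ : ℕ∞) (fun p : (Fin n → ℂ) × ℝ => (starRingEnd ℂ) (p.1 α)) :=
  Complex.conjCLE.contDiff.comp (contDiff_coord α)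

theorem contDiff_pdt (hF : ContDiff ℝ (⊤ : ℕ∞) F) : ContDiff ℝ (⊤ : ℕ∞) (pdt F) :=
  contDiff_fderiv_const_apply hF _

theorem contDiff_Zh (hF : ContDiff ℝ (⊤ : ℕ∞) F) (α : Fin n) :
    ContDiff ℝ (⊤ : ℕ∞) (Zh α F) :=
  (contDiff_const.mul ((contDiff_fderiv_const_apply hF _).sub
    (contDiff_const.mul (contDiff_fderiv_const_apply hF _)))).add
    ((contDiff_const.mul (contDiff_conj_coord α)).mul (contDiff_pdt hF))

theorem hasFDerivAt_coord (α : Fin n) (p : (Fin n → ℂ) × ℝ) :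
    HasFDerivAt (fun q : (Fin n → ℂ) × ℝ => q.1 α)
      ((ContinuousLinearMap.proj (R := ℝ) (φ := fun _ : Fin n => ℂ) α).comp
        (ContinuousLinearMap.fst ℝ (Fin n → ℂ) ℝ)) p :=
  ((ContinuousLinearMap.proj (R := ℝ) (φ := fun _ : Fin n => ℂ) α).comp
    (ContinuousLinearMap.fst ℝ (Fin n → ℂ) ℝ)).hasFDerivAt

theorem hasFDerivAt_conj_coord (α : Fin n) (p : (Fin n → ℂ) × ℝ) :
    HasFDerivAt (fun q : (Fin n → ℂ) × ℝ => (starRingEnd ℂ) (q.1 α))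
      ((Complex.conjCLE : ℂ →L[ℝ] ℂ).comp
        ((ContinuousLinearMap.proj (R := ℝ) (φ := fun _ : Fin n => ℂ) α).comp
          (ContinuousLinearMap.fst ℝ (Fin n → ℂ) ℝ))) p :=
  (Complex.conjCLE : ℂ →L[ℝ] ℂ).hasFDerivAt.comp p (hasFDerivAt_coord α p)

theorem fderiv_pdt_apply (hF : ContDiff ℝ (⊤ : ℕ∞) F) (p v : (Fin n → ℂ) × ℝ) :
    fderiv ℝ (pdt F) p v = fderiv ℝ (fderiv ℝ F) p v (0, 1) := by
  have h : fderiv ℝ (pdt F) p = _ := (hasFDerivAt_fderiv_const_apply hF (0, 1) p).fderiv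
  rw [h, ContinuousLinearMap.comp_apply, ContinuousLinearMap.apply_apply]

theorem fderiv_Zh_apply (hF : ContDiff ℝ (⊤ : ℕ∞) F) (α : Fin n) (p v : (Fin n → ℂ) × ℝ) :
    fderiv ℝ (Zh α F) p v =
      (1 / 2) * (fderiv ℝ (fderiv ℝ F) p v (Pi.single α 1, 0) -
        Complex.I * fderiv ℝ (fderiv ℝ F) p v (Pi.single α Complex.I, 0)) +
      Complex.I * (starRingEnd ℂ) (v.1 α) * pdt F p +
      Complex.I * (starRingEnd ℂ) (p.1 α) * fderiv ℝ (fderiv ℝ F) p v (0, 1) := by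
  have h : fderiv ℝ (Zh α F) p = _ :=
    ((((hasFDerivAt_fderiv_const_apply hF (Pi.single α 1, 0) p).sub
      ((hasFDerivAt_fderiv_const_apply hF (Pi.single α Complex.I, 0) p).const_mul
        Complex.I)).const_mul (1 / 2)).add
      (((hasFDerivAt_conj_coord α p).const_mul Complex.I).mul
        (hasFDerivAt_fderiv_const_apply hF (0, 1) p))).fderiv
  rw [h]
  simp [pdt]
  ring

theorem fderiv_Zhbar_apply (hF : ContDiff ℝ (⊤ : ℕ∞) F) (α : Fin n)
    (p v : (Fin n → ℂ) × ℝ) :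
    fderiv ℝ (Zhbar α F) p v =
      (1 / 2) * (fderiv ℝ (fderiv ℝ F) p v (Pi.single α 1, 0) +
        Complex.I * fderiv ℝ (fderiv ℝ F) p v (Pi.single α Complex.I, 0)) -
      Complex.I * v.1 α * pdt F p -
      Complex.I * p.1 α * fderiv ℝ (fderiv ℝ F) p v (0, 1) := by
  have h : fderiv ℝ (Zhbar α F) p = _ :=
    ((((hasFDerivAt_fderiv_const_apply hF (Pi.single α 1, 0) p).add
      ((hasFDerivAt_fderiv_const_apply hF (Pi.single α Complex.I, 0) p).const_mul
        Complex.I)).const_mul (1 / 2)).sub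
      (((hasFDerivAt_coord α p).const_mul Complex.I).mul
        (hasFDerivAt_fderiv_const_apply hF (0, 1) p))).fderiv
  rw [h]
  simp [pdt]
  ring

theorem pdt_Zh (hF : ContDiff ℝ (⊤ : ℕ∞) F) (α : Fin n) (p : (Fin n → ℂ) × ℝ) :
    pdt (Zh α F) p = Zh α (pdt F) p := by
  rw [pdt, fderiv_Zh_apply hF, Zh, pdz, pdt.eq_1 (pdt F)]
  simp only [fderiv_pdt_apply hF, fderiv_fderiv_symm hF p (0, 1)]
  simp

theorem pdt_Zhbar (hF : ContDiff ℝ (⊤ : ℕ∞) F) (α : Fin n) (p : (Fin n → ℂ) × ℝ) :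
    pdt (Zhbar α F) p = Zhbar α (pdt F) p := by
  rw [pdt, fderiv_Zhbar_apply hF, Zhbar, pdzbar, pdt.eq_1 (pdt F)]
  simp only [fderiv_pdt_apply hF, fderiv_fderiv_symm hF p (0, 1)]
  simp

/-- The commutation relation `[Z_α, Z̄_α] = -2i ∂/∂t`. -/
theorem Zh_Zhbar (hF : ContDiff ℝ (⊤ : ℕ∞) F) (α : Fin n) (p : (Fin n → ℂ) × ℝ) :
    Zh α (Zhbar α F) p = Zhbar α (Zh α F) p - 2 * Complex.I * pdt F p := by
  rw [Zh, pdz, pdt.eq_1 (Zhbar α F), Zhbar.eq_1 α (Zh α F), pdzbar, pdt.eq_1 (Zh α F)]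
  simp only [fderiv_Zh_apply hF, fderiv_Zhbar_apply hF]
  rw [fderiv_fderiv_symm hF p (Pi.single α Complex.I, 0) (Pi.single α 1, 0),
    fderiv_fderiv_symm hF p (0, 1) (Pi.single α Complex.I, 0),
    fderiv_fderiv_symm hF p (0, 1) (Pi.single α 1, 0)]
  simp
  ring

@[simp]
theorem Zh_zero (α : Fin n) (p : (Fin n → ℂ) × ℝ) : Zh α (fun _ => 0) p = 0 := by
  simp [Zh, pdz, pdt]

@[simp]
theorem Zhbar_zero (α : Fin n) (p : (Fin n → ℂ) × ℝ) : Zhbar α (fun _ => 0) p = 0 := by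
  simp [Zhbar, pdzbar, pdt]

theorem pdt_zero (p : (Fin n → ℂ) × ℝ) : pdt (fun _ => 0) p = 0 := by
  simp [pdt]

theorem Zh_const_mul (hF : ContDiff ℝ (⊤ : ℕ∞) F) (α : Fin n) (c : ℂ)
    (p : (Fin n → ℂ) × ℝ) : Zh α (fun q => c * F q) p = c * Zh α F p := by
  have h := fderiv_const_mul ((hF.differentiable (by simp)) p) c
  simp only [Zh, pdz, pdt, h, smul_apply, smul_eq_mul]
  ring

theorem fderiv_eq_zero_of_Zh_of_Zhbar {p : (Fin n → ℂ) × ℝ} (hZ : ∀ α, Zh α F p = 0)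
    (hZbar : ∀ α, Zhbar α F p = 0) (ht : pdt F p = 0) : fderiv ℝ F p = 0 := by
  have h1 (α : Fin n) : fderiv ℝ F p (Pi.single α 1, 0) = 0 := by
    have a := hZ α
    have b := hZbar α
    simp only [Zh, Zhbar, pdz, pdzbar, ht] at a b
    linear_combination a + b
  have hI (α : Fin n) : fderiv ℝ F p (Pi.single α Complex.I, 0) = 0 := by
    have b := hZbar α
    simpa [Zhbar, pdzbar, ht, h1 α] using b
  have key (α : Fin n) (w : ℂ) : fderiv ℝ F p (Pi.single α w, 0) = 0 := by
    have hw : ((Pi.single α w, 0) : (Fin n → ℂ) × ℝ) =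
        w.re • (Pi.single α 1, 0) + w.im • (Pi.single α Complex.I, 0) := by
      simp only [Prod.smul_mk, Prod.mk_add_mk, ← Pi.single_smul, ← Pi.single_add]
      simp [Complex.re_add_im]
    rw [hw, map_add, map_smul, map_smul, h1, hI]
    simp
  have hz : (fderiv ℝ F p).toLinearMap.comp (LinearMap.inl ℝ (Fin n → ℂ) ℝ) = 0 :=
    LinearMap.pi_ext fun α w => by simpa using key α w
  ext v
  · simpa using LinearMap.congr_fun hz v
  · simpa [pdt] using ht

end HeisenbergCalculus

/-- If `G : ℂⁿ × ℝ → ℂ` is smooth, CR on `ℍⁿ` (`Z̄_α G = 0`) and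
satisfies `Z_β Z_α G = 0` for all `α, β`, then `∂G/∂t` is constant on `ℂⁿ × ℝ`. -/
theorem cr_second_order_dt_const (n : ℕ) (hn : 1 ≤ n) (G : (Fin n → ℂ) × ℝ → ℂ)
    (hG : ContDiff ℝ (⊤ : ℕ∞) G)
    (hCR : ∀ (α : Fin n) (p : (Fin n → ℂ) × ℝ), Zhbar α G p = 0)
    (h2 : ∀ (α β : Fin n) (p : (Fin n → ℂ) × ℝ), Zh β (fun q => Zh α G q) p = 0) :
    ∃ c : ℂ, ∀ p : (Fin n → ℂ) × ℝ, pdt G p = c := by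
  have hu : ContDiff ℝ (⊤ : ℕ∞) (pdt G) := contDiff_pdt hG
  have hCR' (α : Fin n) : Zhbar α G = fun _ => 0 := funext (hCR α)
  have hZZ (α : Fin n) : Zh α (Zh α G) = fun _ => 0 := funext (h2 α α)
  have hZbarZ (α : Fin n) : Zhbar α (Zh α G) = fun q => 2 * Complex.I * pdt G q := by
    funext q
    have h := Zh_Zhbar hG α q
    rw [hCR', Zh_zero] at h
    linear_combination -h
  have hZu (α : Fin n) (p) : Zh α (pdt G) p = 0 := by
    have h := Zh_Zhbar (contDiff_Zh hG α) α p
    rw [hZbarZ, hZZ, Zhbar_zero, Zh_const_mul hu, pdt_Zh hG] at h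
    have h4 : (4 * Complex.I) * Zh α (pdt G) p = 0 := by linear_combination h
    simpa using h4
  have hZbaru (α : Fin n) (p) : Zhbar α (pdt G) p = 0 := by
    rw [← pdt_Zhbar hG, hCR', pdt_zero]
  have htu (p) : pdt (pdt G) p = 0 := by
    have h := Zh_Zhbar hu ⟨0, hn⟩ p
    rw [funext (hZu ⟨0, hn⟩), funext (hZbaru ⟨0, hn⟩), Zh_zero, Zhbar_zero] at h
    simpa using h
  refine ⟨pdt G 0, fun p => is_const_of_fderiv_eq_zero (𝕜 := ℝ)
    (hu.differentiable (by simp)) (fun q => ?_) p 0⟩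
  exact fderiv_eq_zero_of_Zh_of_Zhbar (hZu · q) (hZbaru · q) (htu q)
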